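/- (Lemma 2.1) Let 1 ≤ k ≤ m, let y ∈ ℝ^m be sorted in nonincreasing order, let ȳ := proj_{B_k}(y) have index pair (k̄0, k̄1) associated with k and partition (ᾱ, β̄, γ̄), and let (ȳ, μ̄, λ̄, θ̄) satisfy the projection KKT conditions. Then proj_{B_k} is Fréchet differentiable at y if and only if y satisfies one of the following three properties: (1) T_k(y) < 0; (2) T_k(y) > 0, k < k̄1, and y_{k̄0+1} − λ̄ < θ̄ < y_{k̄1}; (3) T_k(y) > 0 and k = k̄1. -/

import Mathlib

open Filter Topology Matrix

noncomputable def topkSum {ι : Type*} [Fintype ι] (k : ℕ) (x : ι → ℝ) : ℝ :=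
  sSup {v : ℝ | ∃ s : Finset ι, s.card = k ∧ v = ∑ i ∈ s, x i}

def Bk (m k : ℕ) : Set (Fin m → ℝ) := {x | topkSum k x ≤ 0}

noncomputable def sortDesc {m : ℕ} (x : Fin m → ℝ) : Fin m → ℝ :=
  fun i => (x ∘ Tuple.sort x) i.rev

noncomputable def ent {m : ℕ} (x : Fin m → ℝ) (i : ℕ) : ℝ :=
  if h : 1 ≤ i ∧ i ≤ m then x ⟨i - 1, by omega⟩ else 0

noncomputable def entE {m : ℕ} (x : Fin m → ℝ) (i : ℕ) : EReal :=
  if h : 1 ≤ i ∧ i ≤ m then ((x ⟨i - 1, by omega⟩ : ℝ) : EReal)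
  else if i = 0 then ⊤ else ⊥

def IsIndexPairOf {m : ℕ} (k : ℕ) (x : Fin m → ℝ) (k0 k1 : ℕ) : Prop :=
  k0 + 1 ≤ k ∧ k ≤ k1 ∧ k1 ≤ m ∧
  entE x (k0 + 1) < entE x k0 ∧
  (∀ i : ℕ, k0 + 1 ≤ i → i ≤ k1 → entE x i = entE x k) ∧
  entE x (k1 + 1) < entE x k1

def IsEProjOn {m : ℕ} (S : Set (Fin m → ℝ)) (y p : Fin m → ℝ) : Prop :=
  p ∈ S ∧ ∀ z ∈ S, ∑ i, (y i - p i) ^ 2 ≤ ∑ i, (y i - z i) ^ 2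

def ProjKKT {m : ℕ} (k : ℕ) (y ybar μ : Fin m → ℝ) (lam θ : ℝ) (k0 k1 : ℕ) : Prop :=
  IsIndexPairOf k ybar k0 k1 ∧
  (∀ i : Fin m, (i : ℕ) < k0 → ybar i = y i - lam ∧ μ i = 1) ∧
  (∀ i : Fin m, k0 ≤ (i : ℕ) → (i : ℕ) < k1 →
      ybar i = y i - lam * μ i ∧ ybar i = θ ∧ 0 ≤ μ i ∧ μ i ≤ 1) ∧
  (∑ i : Fin m, (if k0 ≤ (i : ℕ) ∧ (i : ℕ) < k1 then μ i else 0)) = (k : ℝ) - (k0 : ℝ) ∧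
  (∀ i : Fin m, k1 ≤ (i : ℕ) → ybar i = y i ∧ μ i = 0) ∧
  (∑ i : Fin m, (if (i : ℕ) < k0 then y i else 0)) - (k0 : ℝ) * lam + ((k : ℝ) - (k0 : ℝ)) * θ = 0 ∧
  0 < lam ∧
  (θ : EReal) < entE ybar k0 ∧ entE ybar (k1 + 1) < (θ : EReal)

noncomputable def cvar {m : ℕ} (τ : ℝ) (g : Fin m → ℝ) : ℝ :=
  ⨅ t : ℝ, t + (1 / ((1 - τ) * m)) * ∑ j, max (g j - t) 0

/-- A subset sum over `k` indices is bounded by the top-`k` sum. -/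
lemma sum_le_topkSum {ι : Type*} [Fintype ι] {k : ℕ} (x : ι → ℝ) {s : Finset ι}
    (hs : s.card = k) : ∑ i ∈ s, x i ≤ topkSum k x := by
  refine le_csSup ?_ ⟨s, hs, rfl⟩
  refine ((Set.toFinite (Set.univ : Set (Finset ι))).image fun t => ∑ i ∈ t, x i).bddAbove.mono ?_
  rintro v ⟨t, -, rfl⟩
  exact ⟨t, trivial, rfl⟩

/-- Among the `k`-element index sets there is one separated from its complement by a threshold. -/
lemma exists_card_eq_threshold {m k : ℕ} (hk : 1 ≤ k) (hkm : k ≤ m) (x : Fin m → ℝ) :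
    ∃ s : Finset (Fin m), s.card = k ∧ ∃ t : ℝ, (∀ i ∈ s, t ≤ x i) ∧ ∀ i ∉ s, x i ≤ t := by
  obtain ⟨s, hs, hmax⟩ := Finset.exists_max_image
    (Finset.powersetCard k (Finset.univ : Finset (Fin m))) (fun s => ∑ i ∈ s, x i)
    (Finset.powersetCard_nonempty.2 (by simpa using hkm))
  rw [Finset.mem_powersetCard] at hs
  obtain ⟨i₀, hi₀, hmin⟩ := Finset.exists_min_image s x
    (Finset.card_pos.1 (by rw [hs.2]; exact hk))
  refine ⟨s, hs.2, x i₀, hmin, fun j hj => ?_⟩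
  have hj' : j ∉ s.erase i₀ := fun h => hj (Finset.mem_of_mem_erase h)
  have hexch := hmax (insert j (s.erase i₀)) (by
    rw [Finset.mem_powersetCard]
    refine ⟨Finset.subset_univ _, ?_⟩
    rw [Finset.card_insert_of_notMem hj', Finset.card_erase_of_mem hi₀, hs.2]
    omega)
  have herase := Finset.sum_erase_add s x hi₀
  simp only [Finset.sum_insert hj'] at hexch
  linarith

/-- The top-`k` sum dominates every linear functional with weights in `[0, 1]` of total mass `k`. -/
lemma weighted_sum_le_topkSum {m k : ℕ} (hk : 1 ≤ k) (hkm : k ≤ m) {μ : Fin m → ℝ}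
    (h0 : ∀ i, 0 ≤ μ i) (h1 : ∀ i, μ i ≤ 1) (hμ : ∑ i, μ i = k) (x : Fin m → ℝ) :
    ∑ i, μ i * x i ≤ topkSum k x := by
  obtain ⟨s, hs, t, hge, hle⟩ := exists_card_eq_threshold hk hkm x
  refine le_trans ?_ (sum_le_topkSum x hs)
  have hterm : ∑ i, μ i * (x i - t) ≤ ∑ i, if i ∈ s then x i - t else 0 := by
    refine Finset.sum_le_sum fun i _ => ?_
    split_ifs with hi
    · nlinarith [hge i hi, h1 i]
    · nlinarith [hle i hi, h0 i]
  have hleft : ∑ i, μ i * (x i - t) = ∑ i, μ i * x i - k * t := by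
    simp only [mul_sub, Finset.sum_sub_distrib, ← Finset.sum_mul, hμ]
  have hright : (∑ i, if i ∈ s then x i - t else 0) = ∑ i ∈ s, x i - k * t := by
    rw [Finset.sum_ite_mem, Finset.univ_inter, Finset.sum_sub_distrib, Finset.sum_const, hs,
      nsmul_eq_mul]
  linarith

/-- Optimality certificate for `p` to be the projection of `z` onto `Bk m k`. -/
structure IsProjCert {m : ℕ} (k : ℕ) (z p μ : Fin m → ℝ) (lam θ : ℝ) : Prop where
  lam_nonneg : 0 ≤ lam
  decomp : ∀ i, z i = p i + lam * μ i
  nonneg : ∀ i, 0 ≤ μ i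
  le_one : ∀ i, μ i ≤ 1
  sum_eq : ∑ i, μ i = k
  eq_one : ∀ i, θ < p i → μ i = 1
  eq_zero : ∀ i, p i < θ → μ i = 0
  compl : ∑ i, μ i * p i = 0

lemma IsProjCert.mem_Bk {m k : ℕ} (hkm : k ≤ m) {z p μ : Fin m → ℝ}
    {lam θ : ℝ} (h : IsProjCert k z p μ lam θ) : p ∈ Bk m k := by
  show sSup _ ≤ (0 : ℝ)
  refine csSup_le ?_ ?_
  · obtain ⟨s, -, hs⟩ := Finset.exists_subset_card_eq
      (s := (Finset.univ : Finset (Fin m))) (n := k) (by simpa using hkm)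
    exact ⟨_, s, hs, rfl⟩
  · rintro v ⟨s, hs, rfl⟩
    have hterm : (∑ i, if i ∈ s then p i - θ else 0) ≤ ∑ i, μ i * (p i - θ) := by
      refine Finset.sum_le_sum fun i _ => ?_
      rcases lt_trichotomy (p i) θ with hi | hi | hi
      · rw [h.eq_zero i hi]; split_ifs <;> linarith
      · simp [hi]
      · rw [h.eq_one i hi]; split_ifs <;> linarith
    have hright : ∑ i, μ i * (p i - θ) = - (k * θ) := by
      simp only [mul_sub, Finset.sum_sub_distrib, ← Finset.sum_mul, h.sum_eq, h.compl, zero_sub]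
    have hleft : (∑ i, if i ∈ s then p i - θ else 0) = ∑ i ∈ s, p i - k * θ := by
      rw [Finset.sum_ite_mem, Finset.univ_inter, Finset.sum_sub_distrib, Finset.sum_const, hs,
        nsmul_eq_mul]
    linarith

/-- A certified point is the unique projection. -/
lemma IsProjCert.eq_of_isEProjOn {m k : ℕ} (hk : 1 ≤ k) (hkm : k ≤ m) {z p μ q : Fin m → ℝ}
    {lam θ : ℝ} (h : IsProjCert k z p μ lam θ) (hq : IsEProjOn (Bk m k) z q) : q = p := by
  have hmin := hq.2 p (h.mem_Bk hkm)
  have hμq : ∑ i, μ i * q i ≤ 0 :=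
    (weighted_sum_le_topkSum hk hkm h.nonneg h.le_one h.sum_eq q).trans hq.1
  have hexpand : ∑ i, (z i - q i) ^ 2 = ∑ i, (z i - p i) ^ 2 + ∑ i, (q i - p i) ^ 2
      - 2 * lam * (∑ i, μ i * q i - ∑ i, μ i * p i) := by
    rw [← Finset.sum_sub_distrib, Finset.mul_sum, ← Finset.sum_add_distrib,
      ← Finset.sum_sub_distrib]
    refine Finset.sum_congr rfl fun i _ => ?_
    rw [h.decomp i]; ring
  rw [h.compl] at hexpand
  have hsq : ∑ i, (q i - p i) ^ 2 ≤ 0 := by nlinarith [h.lam_nonneg]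
  have hzero := (Finset.sum_eq_zero_iff_of_nonneg fun i _ => sq_nonneg (q i - p i)).1
    (le_antisymm hsq (Finset.sum_nonneg fun i _ => sq_nonneg _))
  funext i
  exact sub_eq_zero.1 (pow_eq_zero_iff two_ne_zero |>.1 (hzero i (Finset.mem_univ i)))

lemma IsProjCert.topkSum_pos {m k : ℕ} (hk : 1 ≤ k) (hkm : k ≤ m) {z p μ : Fin m → ℝ}
    {lam θ : ℝ} (h : IsProjCert k z p μ lam θ) (hlam : 0 < lam) : 0 < topkSum k z := by
  refine lt_of_lt_of_le ?_
    (weighted_sum_le_topkSum hk hkm h.nonneg h.le_one h.sum_eq z)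
  have hsum : ∑ i, μ i * z i = lam * ∑ i, μ i ^ 2 := by
    rw [Finset.mul_sum, ← zero_add (∑ i, lam * μ i ^ 2), ← h.compl, ← Finset.sum_add_distrib]
    refine Finset.sum_congr rfl fun i _ => ?_
    rw [h.decomp i]; ring
  rw [hsum]
  refine mul_pos hlam (lt_of_le_of_ne (Finset.sum_nonneg fun i _ => sq_nonneg _) fun h0 => ?_)
  have hzero := (Finset.sum_eq_zero_iff_of_nonneg fun i _ => sq_nonneg (μ i)).1 h0.symm
  have hμ0 : ∑ i, μ i = 0 :=
    Finset.sum_eq_zero fun i hi => pow_eq_zero_iff two_ne_zero |>.1 (hzero i hi)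
  rw [h.sum_eq] at hμ0
  have : k = 0 := by exact_mod_cast hμ0
  omega

/-- If a projection is differentiable at `y` and moves rigidly along the ray in direction `a`,
then `a` sums to zero over every `k`-set on which the projected point sums to zero. -/
lemma sum_direction_eq_zero {m k : ℕ} {P : (Fin m → ℝ) → Fin m → ℝ}
    (hP : ∀ z, P z ∈ Bk m k) {y a : Fin m → ℝ} (hd : DifferentiableAt ℝ P y)
    (ha : ∀ᶠ t in 𝓝[>] (0 : ℝ), P (y + t • a) = P y + t • a)
    {s : Finset (Fin m)} (hs : s.card = k) (hs0 : ∑ i ∈ s, P y i = 0) :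
    ∑ i ∈ s, a i = 0 := by
  set f : ℝ → ℝ := fun t => ∑ i ∈ s, P (y + t • a) i with hf
  have hf0 : f 0 = 0 := by simpa [hf] using hs0
  have hdf : DifferentiableAt ℝ f 0 := by
    have hline : DifferentiableAt ℝ (fun t : ℝ => P (y + t • a)) 0 := by
      refine DifferentiableAt.comp (0 : ℝ) (g := P) ?_ (by fun_prop)
      simpa using hd
    exact DifferentiableAt.fun_sum fun i _ => differentiableAt_pi.1 hline i
  have hmax : IsLocalMax f 0 := Filter.Eventually.of_forall fun t => by
    rw [hf0]
    exact (sum_le_topkSum _ hs).trans (hP _)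
  have hderiv : HasDerivWithinAt f 0 (Set.Ioi 0) 0 := by
    have := hdf.hasDerivAt
    rw [hmax.deriv_eq_zero] at this
    exact this.hasDerivWithinAt
  have hright : HasDerivWithinAt f (∑ i ∈ s, a i) (Set.Ioi 0) 0 := by
    have hlin : HasDerivWithinAt (fun t : ℝ => t * ∑ i ∈ s, a i) (∑ i ∈ s, a i)
        (Set.Ioi 0) 0 := by
      simpa using ((hasDerivAt_id (0 : ℝ)).mul_const (∑ i ∈ s, a i)).hasDerivWithinAt
    refine hlin.congr_of_eventuallyEq ?_ (by simp [hf0])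
    filter_upwards [ha] with t ht
    simp only [hf, ht, Pi.add_apply, Pi.smul_apply, smul_eq_mul, Finset.sum_add_distrib, hs0,
      zero_add, Finset.mul_sum]
  exact (uniqueDiffWithinAt_Ioi (0 : ℝ)).eq_deriv _ hright hderiv

/-- Sum of a function supported on two consecutive blocks of indices. -/
lemma sum_blocks {m k0 k1 : ℕ} (f g : Fin m → ℝ) :
    (∑ i : Fin m, if (i : ℕ) < k0 then f i else if (i : ℕ) < k1 then g i else 0) =
      (∑ i : Fin m, if (i : ℕ) < k0 then f i else 0) +
        ∑ i : Fin m, if k0 ≤ (i : ℕ) ∧ (i : ℕ) < k1 then g i else 0 := by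
  rw [← Finset.sum_add_distrib]
  refine Finset.sum_congr rfl fun i _ => ?_
  split_ifs <;> first | omega | simp

lemma sum_block_const {m k0 k1 : ℕ} (h01 : k0 ≤ k1) (h1 : k1 ≤ m) (c : ℝ) :
    (∑ i : Fin m, if k0 ≤ (i : ℕ) ∧ (i : ℕ) < k1 then c else 0) = ((k1 : ℝ) - k0) * c := by
  rw [Fin.sum_univ_eq_sum_range (fun i => if k0 ≤ i ∧ i < k1 then c else 0) m,
    ← Finset.sum_filter]
  have : (Finset.range m).filter (fun i => k0 ≤ i ∧ i < k1) = Finset.Ico k0 k1 := by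
    ext i; simp; omega
  rw [this, Finset.sum_const, Nat.card_Ico, nsmul_eq_mul, Nat.cast_sub h01]

lemma sum_initial_const {m k0 : ℕ} (h0 : k0 ≤ m) (c : ℝ) :
    (∑ i : Fin m, if (i : ℕ) < k0 then c else 0) = k0 * c := by
  simpa using sum_block_const (Nat.zero_le k0) h0 c

lemma ent_eq {m : ℕ} (x : Fin m → ℝ) (i : Fin m) : ent x (i + 1) = x i := by
  simp [ent, Nat.succ_le_of_lt i.2]

lemma entE_eq {m : ℕ} (x : Fin m → ℝ) (i : Fin m) : entE x (i + 1) = (x i : EReal) := by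
  simp [entE, Nat.succ_le_of_lt i.2]

section KKT

variable {m k : ℕ} {y p μ : Fin m → ℝ} {lam θ : ℝ} {k0 k1 : ℕ}

lemma ProjKKT.lt_of_lt (h : ProjKKT k y p μ lam θ k0 k1) (hy : Antitone y) {i : Fin m}
    (hi : (i : ℕ) < k0) : θ < p i := by
  obtain ⟨⟨h1, h2, h3, -⟩, hα, -, -, -, -, -, hθ, -⟩ := h
  have hk0 : k0 - 1 < m := by omega
  have hlast := entE_eq p ⟨k0 - 1, hk0⟩
  rw [show ((⟨k0 - 1, hk0⟩ : Fin m) : ℕ) + 1 = k0 by simp; omega] at hlast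
  rw [hlast, EReal.coe_lt_coe_iff, (hα ⟨k0 - 1, hk0⟩ (by simp; omega)).1] at hθ
  have := hy (show i ≤ ⟨k0 - 1, hk0⟩ from Fin.le_def.2 (by simp; omega))
  rw [(hα i hi).1]
  linarith

lemma ProjKKT.lt_of_le (h : ProjKKT k y p μ lam θ k0 k1) (hy : Antitone y) {i : Fin m}
    (hi : k1 ≤ (i : ℕ)) : p i < θ := by
  obtain ⟨-, -, -, -, hγ, -, -, -, hθ⟩ := h
  have hk1 : k1 < m := hi.trans_lt i.2
  rw [entE_eq p ⟨k1, hk1⟩, EReal.coe_lt_coe_iff, (hγ ⟨k1, hk1⟩ le_rfl).1] at hθ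
  have := hy (show (⟨k1, hk1⟩ : Fin m) ≤ i from hi)
  rw [(hγ i hi).1]
  linarith

lemma ProjKKT.sum_mul (h : ProjKKT k y p μ lam θ k0 k1) (f : Fin m → ℝ) :
    ∑ i, μ i * f i = (∑ i : Fin m, if (i : ℕ) < k0 then f i else 0) +
      ∑ i : Fin m, if k0 ≤ (i : ℕ) ∧ (i : ℕ) < k1 then μ i * f i else 0 := by
  obtain ⟨-, hα, -, -, hγ, -⟩ := h
  rw [← sum_blocks]
  refine Finset.sum_congr rfl fun i _ => ?_
  split_ifs with h1 h2
  · rw [(hα i h1).2, one_mul]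
  · rfl
  · rw [(hγ i (by omega)).2, zero_mul]

lemma ProjKKT.isProjCert (h : ProjKKT k y p μ lam θ k0 k1) (hy : Antitone y) :
    IsProjCert k y p μ lam θ := by
  have hlt := fun i => h.lt_of_lt hy (i := i)
  have hle := fun i => h.lt_of_le hy (i := i)
  have hsum := h.sum_mul
  obtain ⟨⟨hk0, hk1, hkm, -⟩, hα, hβ, hr, hγ, heq, hlam, -, -⟩ := h
  have key : ∀ i : Fin m, (i : ℕ) < k0 ∨ (k0 ≤ (i : ℕ) ∧ (i : ℕ) < k1) ∨ k1 ≤ (i : ℕ) :=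
    fun i => by omega
  refine ⟨hlam.le, fun i => ?_, fun i => ?_, fun i => ?_, ?_, fun i hi => ?_, fun i hi => ?_, ?_⟩
  · rcases key i with hi | ⟨hi, hi'⟩ | hi
    · rw [(hα i hi).1, (hα i hi).2]; ring
    · rw [(hβ i hi hi').1]; ring
    · rw [(hγ i hi).1, (hγ i hi).2]; ring
  · rcases key i with hi | ⟨hi, hi'⟩ | hi
    · rw [(hα i hi).2]; exact zero_le_one
    · exact (hβ i hi hi').2.2.1
    · rw [(hγ i hi).2]
  · rcases key i with hi | ⟨hi, hi'⟩ | hi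
    · rw [(hα i hi).2]
    · exact (hβ i hi hi').2.2.2
    · rw [(hγ i hi).2]; exact zero_le_one
  · have := hsum fun _ => 1
    simp only [mul_one] at this
    rw [this, hr, sum_initial_const (by omega)]
    ring
  · rcases key i with hi' | ⟨hi', hi''⟩ | hi'
    · exact (hα i hi').2
    · exact absurd (hβ i hi' hi'').2.1 hi.ne'
    · exact absurd (hle i hi') hi.not_gt
  · rcases key i with hi' | ⟨hi', hi''⟩ | hi'
    · exact absurd (hlt i hi') hi.not_gt
    · exact absurd (hβ i hi' hi'').2.1 hi.ne
    · exact (hγ i hi').2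
  · have hA : (∑ i : Fin m, if (i : ℕ) < k0 then p i else 0) =
        (∑ i : Fin m, if (i : ℕ) < k0 then y i else 0) - k0 * lam := by
      rw [← sum_initial_const (show k0 ≤ m by omega) lam, ← Finset.sum_sub_distrib]
      refine Finset.sum_congr rfl fun i _ => ?_
      split_ifs with hi
      · exact (hα i hi).1
      · simp
    have hB : (∑ i : Fin m, if k0 ≤ (i : ℕ) ∧ (i : ℕ) < k1 then μ i * p i else 0) =
        (k - k0) * θ := by
      rw [← hr, Finset.sum_mul]
      refine Finset.sum_congr rfl fun i _ => ?_
      split_ifs with hi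
      · rw [(hβ i hi.1 hi.2).2.1]
      · simp
    rw [hsum, hA, hB]
    exact heq

/-- The projection sums to zero over any `k`-set between the leading block and the tie block. -/
lemma ProjKKT.sum_eq_zero (h : ProjKKT k y p μ lam θ k0 k1) (hy : Antitone y)
    {s : Finset (Fin m)} (hs : s.card = k) (hα : ∀ i : Fin m, (i : ℕ) < k0 → i ∈ s)
    (hγ : ∀ i ∈ s, (i : ℕ) < k1) : ∑ i ∈ s, p i = 0 := by
  have hc := h.isProjCert hy
  have hterm : ∑ i, μ i * (p i - θ) = ∑ i, if i ∈ s then p i - θ else 0 := by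
    refine Finset.sum_congr rfl fun i _ => ?_
    by_cases hi : k0 ≤ (i : ℕ) ∧ (i : ℕ) < k1
    · simp [(h.2.2.1 i hi.1 hi.2).2.1]
    · by_cases hi0 : (i : ℕ) < k0
      · rw [if_pos (hα i hi0), (h.2.1 i hi0).2, one_mul]
      · rw [if_neg fun his => hi ⟨by omega, hγ i his⟩,
          (h.2.2.2.2.1 i (by omega)).2, zero_mul]
  rw [Finset.sum_ite_mem, Finset.univ_inter, Finset.sum_sub_distrib, Finset.sum_const, hs,
    nsmul_eq_mul] at hterm
  simp only [mul_sub, Finset.sum_sub_distrib, ← Finset.sum_mul, hc.sum_eq, hc.compl] at hterm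
  linarith

variable {P : (Fin m → ℝ) → Fin m → ℝ}

/-- A vanishing multiplier inside the tie block breaks differentiability. -/
lemma ProjKKT.not_differentiableAt_of_eq_zero (hk : 1 ≤ k)
    (hP : ∀ z, IsEProjOn (Bk m k) z (P z)) (h : ProjKKT k y (P y) μ lam θ k0 k1)
    (hy : Antitone y) {j : Fin m} (hj0 : k0 ≤ (j : ℕ)) (hj1 : (j : ℕ) < k1)
    (hj : μ j = 0) : ¬ DifferentiableAt ℝ P y := by
  intro hd
  have hc := h.isProjCert hy
  obtain ⟨h1, h2, h3, -⟩ := h.1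
  obtain ⟨s, hsub, hsup, hs⟩ := Finset.exists_subsuperset_card_eq (n := k)
    (s := insert j (Finset.univ.filter fun i : Fin m => (i : ℕ) < k0))
    (t := Finset.univ.filter fun i : Fin m => (i : ℕ) < k1)
    (by intro i hi
        simp only [Finset.mem_insert, Finset.mem_filter, Finset.mem_univ, true_and] at hi ⊢
        rcases hi with rfl | hi <;> omega)
    (by refine (Finset.card_insert_le _ _).trans ?_
        rw [Fin.card_filter_val_lt]; omega)
    (by rw [Fin.card_filter_val_lt]; omega)
  have hjs : j ∈ s := hsub (Finset.mem_insert_self _ _)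
  have hs0 := h.sum_eq_zero hy hs
    (fun i hi => hsub (Finset.mem_insert_of_mem (by simpa using hi)))
    (fun i hi => by simpa using hsup hi)
  have := sum_direction_eq_zero (fun z => (hP z).1) hd (a := Pi.single j (-1)) ?_ hs hs0
  · rw [Finset.sum_pi_single', if_pos hjs] at this
    norm_num at this
  · filter_upwards [self_mem_nhdsWithin] with t ht
    have ht : 0 < t := ht
    refine IsProjCert.eq_of_isEProjOn hk (h2.trans h3) (μ := μ) (lam := lam) (θ := θ) ?_ (hP _)
    have hpj := (h.2.2.1 j hj0 hj1).2.1
    refine ⟨hc.lam_nonneg, fun i => ?_, hc.nonneg, hc.le_one, hc.sum_eq, fun i hi => ?_,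
      fun i hi => ?_, ?_⟩
    · simp only [Pi.add_apply, hc.decomp i]; ring
    · by_cases hij : i = j
      · subst hij
        simp [hpj] at hi
        linarith
      · exact hc.eq_one i (by simpa [hij] using hi)
    · by_cases hij : i = j
      · rw [hij, hj]
      · exact hc.eq_zero i (by simpa [hij] using hi)
    · have hz : ∀ i, μ i * (P y + t • (Pi.single j (-1) : Fin m → ℝ)) i = μ i * P y i := by
        intro i
        by_cases hij : i = j
        · rw [hij, hj, zero_mul, zero_mul]
        · simp [hij]
      simp only [hz, hc.compl]

/-- A saturated multiplier inside a tie block of size larger than needed breaks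
differentiability. -/
lemma ProjKKT.not_differentiableAt_of_eq_one (hk : 1 ≤ k) (hkk1 : k < k1)
    (hP : ∀ z, IsEProjOn (Bk m k) z (P z)) (h : ProjKKT k y (P y) μ lam θ k0 k1)
    (hy : Antitone y) {j : Fin m} (hj0 : k0 ≤ (j : ℕ)) (hj1 : (j : ℕ) < k1)
    (hj : μ j = 1) : ¬ DifferentiableAt ℝ P y := by
  intro hd
  have hc := h.isProjCert hy
  obtain ⟨h1, h2, h3, -⟩ := h.1
  obtain ⟨s, hsub, hsup, hs⟩ := Finset.exists_subsuperset_card_eq (n := k)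
    (s := Finset.univ.filter fun i : Fin m => (i : ℕ) < k0)
    (t := (Finset.univ.filter fun i : Fin m => (i : ℕ) < k1).erase j)
    (by intro i hi
        simp only [Finset.mem_erase, Finset.mem_filter, Finset.mem_univ, true_and] at hi ⊢
        exact ⟨fun hij => by subst hij; omega, by omega⟩)
    (by rw [Fin.card_filter_val_lt]; omega)
    (by rw [Finset.card_erase_of_mem (by simpa using hj1), Fin.card_filter_val_lt]; omega)
  have hjs : j ∉ s := fun hjs => by simpa using hsup hjs
  have hsk1 : ∀ i ∈ s, (i : ℕ) < k1 := fun i hi => by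
    simpa using Finset.mem_of_mem_erase (hsup hi)
  have hs0 := h.sum_eq_zero hy hs (fun i hi => hsub (by simpa using hi)) hsk1
  set r : ℝ := (k : ℝ) - k0 with hr
  have hrpos : 0 < r := by
    have : (k0 : ℝ) + 1 ≤ k := by exact_mod_cast h1
    rw [hr]; linarith
  set b : Fin m → ℝ := fun i => if k0 ≤ (i : ℕ) ∧ (i : ℕ) < k1 then -1 else 0 with hb
  have := sum_direction_eq_zero (fun z => (hP z).1) hd (a := b + Pi.single j r) ?_ hs hs0
  · have hsb : ∑ i ∈ s, (b + (Pi.single j r : Fin m → ℝ)) i = -r := by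
      have hval : ∀ i ∈ s, (b + (Pi.single j r : Fin m → ℝ)) i =
          (if (i : ℕ) < k0 then 1 else 0) - 1 := by
        intro i hi
        have hij : i ≠ j := fun e => hjs (e ▸ hi)
        have := hsk1 i hi
        by_cases hi0 : (i : ℕ) < k0
        · simp [hb, hij, hi0]
        · simp [hb, hij, hi0, this, not_lt.1 hi0]
      rw [Finset.sum_congr rfl hval, Finset.sum_sub_distrib, Finset.sum_const, hs,
        ← Finset.sum_filter, Finset.sum_const]
      have hfil : s.filter (fun i : Fin m => (i : ℕ) < k0) =
          Finset.univ.filter fun i : Fin m => (i : ℕ) < k0 := by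
        ext i
        simp only [Finset.mem_filter, Finset.mem_univ, true_and, and_iff_right_iff_imp]
        exact fun hi => hsub (by simpa using hi)
      rw [hfil, Fin.card_filter_val_lt, Nat.min_eq_right (by omega)]
      simp [hr]
    rw [hsb] at this
    linarith
  · have hsmall : ∀ᶠ t in 𝓝[>] (0 : ℝ), ∀ i : Fin m, k1 ≤ (i : ℕ) → t < θ - P y i := by
      refine nhdsWithin_le_nhds (eventually_all.2 fun i => ?_)
      by_cases hi : k1 ≤ (i : ℕ)
      · filter_upwards [eventually_lt_nhds (sub_pos.2 (h.lt_of_le hy hi))] with t ht _ using ht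
      · exact Eventually.of_forall fun t hi' => absurd hi' hi
    filter_upwards [self_mem_nhdsWithin, hsmall] with t ht hts
    have ht : 0 < t := ht
    refine IsProjCert.eq_of_isEProjOn hk (h2.trans h3) (μ := μ) (lam := lam) (θ := θ - t) ?_
      (hP _)
    refine ⟨hc.lam_nonneg, fun i => ?_, hc.nonneg, hc.le_one, hc.sum_eq, fun i hi => ?_,
      fun i hi => ?_, ?_⟩
    · simp only [Pi.add_apply, hc.decomp i]; ring
    · by_cases hij : i = j
      · rw [hij, hj]
      by_cases hi0 : (i : ℕ) < k0
      · exact (h.2.1 i hi0).2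
      exfalso
      simp only [Pi.add_apply, Pi.smul_apply, smul_eq_mul, Pi.single_eq_of_ne hij, hb] at hi
      by_cases hi1 : (i : ℕ) < k1
      · rw [if_pos ⟨not_lt.1 hi0, hi1⟩, (h.2.2.1 i (not_lt.1 hi0) hi1).2.1] at hi
        linarith
      · rw [if_neg fun e => hi1 e.2] at hi
        linarith [hts i (not_lt.1 hi1)]
    · by_cases hi1 : k1 ≤ (i : ℕ)
      · exact (h.2.2.2.2.1 i hi1).2
      exfalso
      have hsing : 0 ≤ (Pi.single j r : Fin m → ℝ) i := by
        by_cases hij : i = j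
        · rw [hij, Pi.single_eq_same]; exact hrpos.le
        · rw [Pi.single_eq_of_ne hij]
      simp only [Pi.add_apply, Pi.smul_apply, smul_eq_mul, hb] at hi
      have := mul_nonneg ht.le hsing
      by_cases hi0 : (i : ℕ) < k0
      · rw [if_neg fun e => by omega] at hi
        linarith [h.lt_of_lt hy hi0]
      · rw [if_pos ⟨not_lt.1 hi0, not_le.1 hi1⟩,
          (h.2.2.1 i (not_lt.1 hi0) (not_le.1 hi1)).2.1] at hi
        linarith
    · have hμb : ∑ i, μ i * b i = -r := by
        rw [hr, ← h.2.2.2.1, ← Finset.sum_neg_distrib]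
        refine Finset.sum_congr rfl fun i _ => ?_
        simp only [hb]
        split_ifs <;> simp
      have hμs : ∑ i, μ i * (Pi.single j r : Fin m → ℝ) i = r := by
        rw [Finset.sum_eq_single j (fun i _ hij => by simp [hij]) (by simp), hj,
          Pi.single_eq_same, one_mul]
      have hsplit : ∀ i, μ i * (P y + t • (b + (Pi.single j r : Fin m → ℝ))) i =
          μ i * P y i + t * (μ i * b i + μ i * (Pi.single j r : Fin m → ℝ) i) := by
        intro i
        simp only [Pi.add_apply, Pi.smul_apply, smul_eq_mul]
        ring
      simp only [hsplit, Finset.sum_add_distrib, ← Finset.mul_sum, hμb, hμs, hc.compl]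
      ring

/-- Without surplus ties the projection subtracts, near `y`, a multiple of a fixed indicator. -/
lemma ProjKKT.differentiableAt_of_eq (hk : 1 ≤ k)
    (hP : ∀ z, IsEProjOn (Bk m k) z (P z)) (h : ProjKKT k y (P y) μ lam θ k0 k)
    (hy : Antitone y) : DifferentiableAt ℝ P y := by
  have hc := h.isProjCert hy
  obtain ⟨h1, -, hkm, -⟩ := h.1
  have hkpos : (0 : ℝ) < k := by exact_mod_cast hk
  have hlam : 0 < lam := h.2.2.2.2.2.2.1
  have hμind : ∀ i, μ i = if (i : ℕ) < k then 1 else 0 := by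
    have hle : ∀ i ∈ Finset.univ, μ i ≤ if (i : ℕ) < k then (1 : ℝ) else 0 := fun i _ => by
      split_ifs with hi
      · exact hc.le_one i
      · exact (h.2.2.2.2.1 i (not_lt.1 hi)).2.le
    have heq := (Finset.sum_eq_sum_iff_of_le hle).1 (by
      rw [hc.sum_eq, sum_initial_const hkm, mul_one])
    exact fun i => heq i (Finset.mem_univ i)
  set L : (Fin m → ℝ) → ℝ := fun z => (∑ i : Fin m, if (i : ℕ) < k then z i else 0) / k with hL
  have hLc : Continuous L := by
    refine Continuous.div_const (continuous_finsetSum _ fun i _ => ?_) _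
    split_ifs <;> fun_prop
  have hLd : DifferentiableAt ℝ L y := by
    have hsum : DifferentiableAt ℝ
        (fun z : Fin m → ℝ => ∑ i : Fin m, if (i : ℕ) < k then z i else 0) y := by
      refine DifferentiableAt.fun_sum fun i _ => ?_
      split_ifs <;> fun_prop
    simp only [hL]; fun_prop
  have hLy : L y = lam := by
    have hcompl := hc.compl
    have hterm : ∀ i, μ i * P y i =
        (if (i : ℕ) < k then y i else 0) - if (i : ℕ) < k then lam else 0 := fun i => by
      rw [hc.decomp i, hμind i]; split_ifs <;> ring
    simp only [hterm, Finset.sum_sub_distrib, sum_initial_const hkm] at hcompl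
    simp only [hL]
    field_simp
    linarith
  obtain ⟨θ', hθ', hγ⟩ : ∃ θ' < θ, ∀ i : Fin m, k ≤ (i : ℕ) → y i < θ' := by
    have hev : ∀ᶠ u in 𝓝[<] θ, ∀ i : Fin m, k ≤ (i : ℕ) → y i < u := by
      refine nhdsWithin_le_nhds (eventually_all.2 fun i => ?_)
      by_cases hi : k ≤ (i : ℕ)
      · have := h.lt_of_le hy hi
        rw [(h.2.2.2.2.1 i hi).1] at this
        filter_upwards [eventually_gt_nhds this] with u hu _ using hu
      · exact Eventually.of_forall fun u hi' => absurd hi' hi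
    obtain ⟨u, hu, hu'⟩ := (hev.and self_mem_nhdsWithin).exists
    exact ⟨u, hu', hu⟩
  have hα : ∀ i : Fin m, (i : ℕ) < k → θ' < y i - L y := fun i hi => by
    have hp : θ ≤ P y i := by
      by_cases hi0 : (i : ℕ) < k0
      · exact (h.lt_of_lt hy hi0).le
      · exact (h.2.2.1 i (not_lt.1 hi0) hi).2.1.ge
    have := hc.decomp i
    rw [hμind i, if_pos hi] at this
    rw [hLy]
    linarith
  have hevL : ∀ᶠ z in 𝓝 y, 0 < L z := hLc.continuousAt.eventually_const_lt (by rw [hLy]; exact hlam)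
  have hevα : ∀ᶠ z in 𝓝 y, ∀ i : Fin m, (i : ℕ) < k → θ' < z i - L z := by
    refine eventually_all.2 fun i => ?_
    by_cases hi : (i : ℕ) < k
    · have hcont : Continuous fun z : Fin m → ℝ => z i - L z := by fun_prop
      filter_upwards [hcont.continuousAt.eventually_const_lt (hα i hi)] with z hz _ using hz
    · exact Eventually.of_forall fun z hi' => absurd hi' hi
  have hevγ : ∀ᶠ z in 𝓝 y, ∀ i : Fin m, k ≤ (i : ℕ) → z i < θ' := by
    refine eventually_all.2 fun i => ?_
    by_cases hi : k ≤ (i : ℕ)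
    · have hcont : Continuous fun z : Fin m → ℝ => z i := by fun_prop
      filter_upwards [hcont.continuousAt.eventually_lt_const (hγ i hi)] with z hz _ using hz
    · exact Eventually.of_forall fun z hi' => absurd hi' hi
  have hloc : P =ᶠ[𝓝 y] fun z i => if (i : ℕ) < k then z i - L z else z i := by
    filter_upwards [hevL, hevα, hevγ] with z hzL hzα hzγ
    refine IsProjCert.eq_of_isEProjOn hk hkm (lam := L z) (θ := θ')
      (μ := fun i => if (i : ℕ) < k then 1 else 0) ?_ (hP z)
    refine ⟨hzL.le, fun i => ?_, fun i => ?_, fun i => ?_, ?_, fun i hi => ?_, fun i hi => ?_, ?_⟩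
    · split_ifs <;> ring
    · split_ifs <;> norm_num
    · split_ifs <;> norm_num
    · rw [sum_initial_const hkm, mul_one]
    · by_contra hne
      have hik : ¬ (i : ℕ) < k := fun hik => hne (if_pos hik)
      rw [if_neg hik] at hi
      exact (hzγ i (not_lt.1 hik)).not_gt hi
    · by_contra hne
      have hik : (i : ℕ) < k := by
        by_contra hik
        exact hne (if_neg hik)
      rw [if_pos hik] at hi
      exact (hzα i hik).not_gt hi
    · have hterm : ∀ i : Fin m, (if (i : ℕ) < k then (1 : ℝ) else 0) *
          (if (i : ℕ) < k then z i - L z else z i) =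
          (if (i : ℕ) < k then z i else 0) - if (i : ℕ) < k then L z else 0 := fun i => by
        split_ifs <;> ring
      simp only [hterm, Finset.sum_sub_distrib, sum_initial_const hkm]
      simp only [hL]
      field_simp
      ring
  refine hloc.differentiableAt_iff.2 (differentiableAt_pi.2 fun i => ?_)
  split_ifs <;> fun_prop

/-- If all multipliers on the tie block are strictly between `0` and `1`, the projection is
linear near `y`. -/
lemma ProjKKT.differentiableAt_of_strict (hk : 1 ≤ k)
    (hP : ∀ z, IsEProjOn (Bk m k) z (P z)) (h : ProjKKT k y (P y) μ lam θ k0 k1)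
    (hy : Antitone y)
    (hβ : ∀ i : Fin m, k0 ≤ (i : ℕ) → (i : ℕ) < k1 → y i - lam < θ ∧ θ < y i) :
    DifferentiableAt ℝ P y := by
  have hc := h.isProjCert hy
  obtain ⟨h1, h2, h3, -⟩ := h.1
  have hlam : 0 < lam := h.2.2.2.2.2.2.1
  have h01 : k0 ≤ k1 := by omega
  set r : ℝ := (k : ℝ) - k0 with hr
  set n : ℝ := (k1 : ℝ) - k0 with hn
  have hrpos : 0 < r := by
    have : (k0 : ℝ) + 1 ≤ k := by exact_mod_cast h1
    rw [hr]; linarith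
  have hnpos : 0 < n := by
    have : (k : ℝ) ≤ k1 := by exact_mod_cast h2
    rw [hn]; linarith
  have hk0 : (0 : ℝ) ≤ k0 := Nat.cast_nonneg _
  set A : (Fin m → ℝ) → ℝ := fun z => ∑ i : Fin m, if (i : ℕ) < k0 then z i else 0 with hA
  set B : (Fin m → ℝ) → ℝ :=
    fun z => ∑ i : Fin m, if k0 ≤ (i : ℕ) ∧ (i : ℕ) < k1 then z i else 0 with hB
  have hden : 0 < k0 * n + r ^ 2 := by positivity
  set L : (Fin m → ℝ) → ℝ := fun z => (n * A z + r * B z) / (k0 * n + r ^ 2) with hL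
  set T : (Fin m → ℝ) → ℝ := fun z => (B z - r * L z) / n with hT
  have hAd : Differentiable ℝ A := by
    refine Differentiable.fun_sum fun i _ => ?_
    split_ifs <;> fun_prop
  have hBd : Differentiable ℝ B := by
    refine Differentiable.fun_sum fun i _ => ?_
    split_ifs <;> fun_prop
  have hLd : Differentiable ℝ L := by
    simp only [hL]; fun_prop
  have hTd : Differentiable ℝ T := by
    simp only [hT]; fun_prop
  have hLc := hLd.continuous
  have hTc := hTd.continuous
  have hBT : ∀ z, B z = n * T z + r * L z := fun z => by
    simp only [hT]; field_simp; ring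
  have hAT : ∀ z, A z - k0 * L z + r * T z = 0 := fun z => by
    have hLz : L z * (k0 * n + r ^ 2) = n * A z + r * B z := div_mul_cancel₀ _ hden.ne'
    have hprod : n * (A z - k0 * L z + r * T z) = 0 := by
      linear_combination (-1) * hLz - r * hBT z
    exact (mul_eq_zero.1 hprod).resolve_left hnpos.ne'
  have hBy : B y = n * θ + r * lam := by
    rw [hr, ← h.2.2.2.1, hn, ← sum_block_const h01 h3 θ, Finset.sum_mul,
      ← Finset.sum_add_distrib]
    refine Finset.sum_congr rfl fun i _ => ?_
    split_ifs with hi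
    · rw [← (h.2.2.1 i hi.1 hi.2).2.1, hc.decomp i]; ring
    · simp
  have hAy : A y - k0 * lam + r * θ = 0 := h.2.2.2.2.2.1
  have hLy : L y = lam := by
    simp only [hL]
    rw [div_eq_iff hden.ne']
    linear_combination n * hAy + r * hBy
  have hTy : T y = θ := by
    simp only [hT]
    rw [div_eq_iff hnpos.ne', hLy]
    linear_combination hBy
  have hevL : ∀ᶠ z in 𝓝 y, 0 < L z := hLc.continuousAt.eventually_const_lt (by rw [hLy]; exact hlam)
  have hevα : ∀ᶠ z in 𝓝 y, ∀ i : Fin m, (i : ℕ) < k0 → 0 < z i - L z - T z := by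
    refine eventually_all.2 fun i => ?_
    by_cases hi : (i : ℕ) < k0
    · have hcont : Continuous fun z : Fin m → ℝ => z i - L z - T z := by fun_prop
      have hyi : 0 < y i - L y - T y := by
        have := h.lt_of_lt hy hi
        rw [(h.2.1 i hi).1] at this
        rw [hLy, hTy]; linarith
      filter_upwards [hcont.continuousAt.eventually_const_lt hyi] with z hz _ using hz
    · exact Eventually.of_forall fun z hi' => absurd hi' hi
  have hevβ : ∀ᶠ z in 𝓝 y, ∀ i : Fin m, k0 ≤ (i : ℕ) ∧ (i : ℕ) < k1 →
      0 < z i - T z ∧ z i - T z - L z < 0 := by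
    refine eventually_all.2 fun i => ?_
    by_cases hi : k0 ≤ (i : ℕ) ∧ (i : ℕ) < k1
    · have hlo : Continuous fun z : Fin m → ℝ => z i - T z := by fun_prop
      have hhi : Continuous fun z : Fin m → ℝ => z i - T z - L z := by fun_prop
      have hyi := hβ i hi.1 hi.2
      have hylo : 0 < y i - T y := by rw [hTy]; linarith
      have hyhi : y i - T y - L y < 0 := by rw [hTy, hLy]; linarith
      filter_upwards [hlo.continuousAt.eventually_const_lt hylo,
        hhi.continuousAt.eventually_lt_const hyhi] with z hz hz' _ using ⟨hz, hz'⟩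
    · exact Eventually.of_forall fun z hi' => absurd hi' hi
  have hevγ : ∀ᶠ z in 𝓝 y, ∀ i : Fin m, k1 ≤ (i : ℕ) → z i - T z < 0 := by
    refine eventually_all.2 fun i => ?_
    by_cases hi : k1 ≤ (i : ℕ)
    · have hcont : Continuous fun z : Fin m → ℝ => z i - T z := by fun_prop
      have hyi : y i - T y < 0 := by
        have := h.lt_of_le hy hi
        rw [(h.2.2.2.2.1 i hi).1] at this
        rw [hTy]; linarith
      filter_upwards [hcont.continuousAt.eventually_lt_const hyi] with z hz _ using hz
    · exact Eventually.of_forall fun z hi' => absurd hi' hi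
  have hloc : P =ᶠ[𝓝 y] fun z i =>
      if (i : ℕ) < k0 then z i - L z else if (i : ℕ) < k1 then T z else z i := by
    filter_upwards [hevL, hevα, hevβ, hevγ] with z hzL hzα hzβ hzγ
    have hBμ : (∑ i : Fin m, if k0 ≤ (i : ℕ) ∧ (i : ℕ) < k1 then (z i - T z) / L z else 0) =
        r := by
      have hterm : ∀ i : Fin m,
          (if k0 ≤ (i : ℕ) ∧ (i : ℕ) < k1 then (z i - T z) / L z else 0) =
          ((if k0 ≤ (i : ℕ) ∧ (i : ℕ) < k1 then z i else 0) -
            if k0 ≤ (i : ℕ) ∧ (i : ℕ) < k1 then T z else 0) / L z := fun i => by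
        split_ifs <;> simp
      simp only [hterm]
      rw [← Finset.sum_div, Finset.sum_sub_distrib, sum_block_const h01 h3, div_eq_iff hzL.ne']
      linear_combination hBT z
    refine IsProjCert.eq_of_isEProjOn hk (h2.trans h3) (lam := L z) (θ := T z)
      (μ := fun i => if (i : ℕ) < k0 then 1 else if (i : ℕ) < k1 then (z i - T z) / L z else 0)
      ?_ (hP z)
    refine ⟨hzL.le, fun i => ?_, fun i => ?_, fun i => ?_, ?_, fun i hi => ?_, fun i hi => ?_, ?_⟩
    · split_ifs <;> field_simp <;> ring
    · split_ifs with hi0 hi1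
      · exact zero_le_one
      · exact (div_pos (hzβ i ⟨not_lt.1 hi0, hi1⟩).1 hzL).le
      · exact le_rfl
    · split_ifs with hi0 hi1
      · exact le_rfl
      · rw [div_le_one hzL]
        linarith [(hzβ i ⟨not_lt.1 hi0, hi1⟩).2]
      · exact zero_le_one
    · rw [sum_blocks, hBμ, sum_initial_const (by omega), hr]
      ring
    · split_ifs at hi ⊢ with hi0 hi1
      · rfl
      · exact absurd hi (lt_irrefl _)
      · linarith [hzγ i (not_lt.1 hi1)]
    · split_ifs at hi ⊢ with hi0 hi1
      · linarith [hzα i hi0]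
      · exact absurd hi (lt_irrefl _)
      · rfl
    · have hterm : ∀ i : Fin m,
          (if (i : ℕ) < k0 then (1 : ℝ) else if (i : ℕ) < k1 then (z i - T z) / L z else 0) *
          (if (i : ℕ) < k0 then z i - L z else if (i : ℕ) < k1 then T z else z i) =
          ((if (i : ℕ) < k0 then z i else 0) - if (i : ℕ) < k0 then L z else 0) +
          (if k0 ≤ (i : ℕ) ∧ (i : ℕ) < k1 then (z i - T z) / L z else 0) * T z := fun i => by
        split_ifs <;> first | omega | ring
      simp only [hterm, Finset.sum_add_distrib, Finset.sum_sub_distrib, ← Finset.sum_mul, hBμ,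
        sum_initial_const (show k0 ≤ m by omega)]
      exact hAT z
  refine hloc.differentiableAt_iff.2 (differentiableAt_pi.2 fun i => ?_)
  split_ifs <;> fun_prop

end KKT

/-- Lemma 2.1: Let `y` be sorted nonincreasingly, `ȳ = proj_{B_k}(y)` with
index pair `(k̄0, k̄1)` and KKT multipliers `(μ̄, λ̄, θ̄)`.  The projection map `proj_{B_k}`
is (Fréchet) differentiable at `y` iff one of:
(1) `T_k(y) < 0`; (2) `T_k(y) > 0`, `k < k̄1` and `y_{k̄0+1} - λ̄ < θ̄ < y_{k̄1}`;
(3) `T_k(y) > 0` and `k = k̄1`. -/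
theorem proj_differentiableAt_iff
    (m k : ℕ) (hk1 : 1 ≤ k) (hkm : k ≤ m)
    (P : (Fin m → ℝ) → (Fin m → ℝ)) (hP : ∀ z, IsEProjOn (Bk m k) z (P z))
    (y ybar : Fin m → ℝ) (hsorted : Antitone y) (hybar : P y = ybar)
    (μ : Fin m → ℝ) (lam θ : ℝ) (k0 k1 : ℕ)
    (hkkt : ProjKKT k y ybar μ lam θ k0 k1) :
    DifferentiableAt ℝ P y ↔
      (topkSum k y < 0 ∨
       (0 < topkSum k y ∧ k < k1 ∧ ent y (k0 + 1) - lam < θ ∧ θ < ent y k1) ∨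
       (0 < topkSum k y ∧ k = k1)) := by
  subst hybar
  have hc := hkkt.isProjCert hsorted
  obtain ⟨h1, h2, h3, -⟩ := hkkt.1
  have hlam : 0 < lam := hkkt.2.2.2.2.2.2.1
  have hpos : 0 < topkSum k y := hc.topkSum_pos hk1 hkm hlam
  have hfirst : ent y (k0 + 1) = y ⟨k0, by omega⟩ := ent_eq y ⟨k0, by omega⟩
  have hlast : ent y k1 = y ⟨k1 - 1, by omega⟩ := by
    have := ent_eq y ⟨k1 - 1, by omega⟩
    rwa [show k1 - 1 + 1 = k1 by omega] at this
  rw [hfirst, hlast]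
  constructor
  · intro hd
    rcases h2.lt_or_eq with hlt | heq
    swap
    · exact Or.inr (Or.inr ⟨hpos, heq⟩)
    have hβ : ∀ i : Fin m, k0 ≤ (i : ℕ) → (i : ℕ) < k1 → y i - lam < θ ∧ θ < y i := by
      intro i hi0 hi1
      have hi := hkkt.2.2.1 i hi0 hi1
      have hμ0 : 0 < μ i := lt_of_le_of_ne hi.2.2.1 fun e =>
        hkkt.not_differentiableAt_of_eq_zero hk1 hP hsorted hi0 hi1 e.symm hd
      have hμ1 : μ i < 1 := lt_of_le_of_ne hi.2.2.2 fun e =>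
        hkkt.not_differentiableAt_of_eq_one hk1 hlt hP hsorted hi0 hi1 e hd
      have hdec := hc.decomp i
      rw [hi.2.1] at hdec
      constructor <;> nlinarith
    exact Or.inr (Or.inl ⟨hpos, hlt, (hβ ⟨k0, by omega⟩ le_rfl (by simp; omega)).1,
      (hβ ⟨k1 - 1, by omega⟩ (by simp; omega) (by simp; omega)).2⟩)
  · rintro (hneg | ⟨-, -, hlo, hhi⟩ | ⟨-, rfl⟩)
    · exact absurd hneg hpos.not_gt
    · refine hkkt.differentiableAt_of_strict hk1 hP hsorted fun i hi0 hi1 => ⟨?_, ?_⟩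
      · have := hsorted (show (⟨k0, by omega⟩ : Fin m) ≤ i from hi0)
        linarith
      · have := hsorted (show i ≤ (⟨k1 - 1, by omega⟩ : Fin m) from Fin.le_def.2 (by simp; omega))
        linarith
    · exact hkkt.differentiableAt_of_eq hk1 hP hsorted
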